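/- Let (t₁,ξ₁),(t₂,ξ₂),(t₃,ξ₃),(t₄,ξ₄) be four distinct points in ℝ² forming a (2,2) configuration: there exist two distinct parallel lines in ℝ² each of which contains exactly two of the four points. If f : ℝ → ℂ is a Schwartz function and d₁,d₂,d₃,d₄ ∈ ℂ are not all zero and satisfy d₁f(x+t₁)e^{2πiξ₁x} + d₂f(x+t₂)e^{2πiξ₂x} + d₃f(x+t₃)e^{2πiξ₃x} + d₄f(x+t₄)e^{2πiξ₄x} = 0 for almost every x ∈ ℝ, then f is identically zero. -/

import Mathlib

open MeasureTheory Filter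

/-- `e x = e^{2πix}`. -/
noncomputable def e (x : ℝ) : ℂ := Complex.exp (2 * Real.pi * Complex.I * x)

open scoped Topology FourierTransform

/-! ### The character `e` -/

lemma e_add (x y : ℝ) : e (x + y) = e x * e y := by
  rw [e, e, e, ← Complex.exp_add]
  push_cast
  ring_nf

lemma e_eq_exp_mul_I (x : ℝ) : e x = Complex.exp ((2 * Real.pi * x : ℝ) * Complex.I) := by
  rw [e]
  push_cast
  ring_nf

lemma norm_e (x : ℝ) : ‖e x‖ = 1 := by
  rw [e_eq_exp_mul_I, Complex.norm_exp_ofReal_mul_I]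

lemma e_ne_zero (x : ℝ) : e x ≠ 0 := Complex.exp_ne_zero _

lemma continuous_e : Continuous e := by
  unfold e
  fun_prop

lemma e_neg (x : ℝ) : e (-x) = (e x)⁻¹ := by
  rw [e, e, ← Complex.exp_neg]
  push_cast
  ring_nf

lemma e_nat_mul (m : ℕ) (x : ℝ) : e (m * x) = e x ^ m := by
  rw [e, e, ← Complex.exp_nat_mul]
  push_cast
  ring_nf

lemma e_int (k : ℤ) : e k = 1 := by
  rw [e, Complex.exp_eq_one_iff]
  exact ⟨k, by push_cast; ring⟩

lemma e_eq_one_iff {x : ℝ} : e x = 1 ↔ ∃ k : ℤ, x = k := by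
  refine ⟨fun h ↦ ?_, fun ⟨k, hk⟩ ↦ hk ▸ e_int k⟩
  obtain ⟨k, hk⟩ := Complex.exp_eq_one_iff.1 h
  refine ⟨k, ?_⟩
  have h2 : (2 * Real.pi * Complex.I : ℂ) ≠ 0 := Complex.two_pi_I_ne_zero
  have : (x : ℂ) = k := mul_left_cancel₀ h2 (by rw [hk]; ring)
  exact_mod_cast this

lemma norm_e_sub_one_le (x : ℝ) : ‖e x - 1‖ ≤ 2 * Real.pi * |x| := by
  have h := Real.norm_exp_I_mul_ofReal_sub_one_le (x := 2 * Real.pi * x)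
  rw [e_eq_exp_mul_I, mul_comm _ Complex.I]
  refine h.trans_eq ?_
  rw [Real.norm_eq_abs, abs_mul, abs_of_pos Real.two_pi_pos]

lemma norm_e_sub_one_le_two (x : ℝ) : ‖e x - 1‖ ≤ 2 := by
  refine (norm_sub_le _ _).trans_eq ?_
  rw [norm_e, norm_one]
  norm_num

lemma norm_e_nat_mul_sub_one_le (m : ℕ) (x : ℝ) : ‖e (m * x) - 1‖ ≤ m * ‖e x - 1‖ := by
  rw [e_nat_mul, ← mul_geom_sum, norm_mul, mul_comm]
  gcongr
  refine (norm_sum_le _ _).trans ?_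
  simp [norm_e]

lemma norm_one_sub_e_neg (x : ℝ) : ‖1 - e (-x)‖ = ‖e x - 1‖ := by
  have : e x - 1 = e x * (1 - e (-x)) := by
    rw [e_neg, mul_sub, mul_inv_cancel₀ (e_ne_zero x), mul_one]
  rw [this, norm_mul, norm_e, one_mul]

/-- Dirichlet's approximation theorem on the circle. -/
lemma exists_norm_e_nat_mul_sub_one_le (x : ℝ) {N : ℕ} (hN : 0 < N) :
    ∃ n : ℕ, 0 < n ∧ n ≤ N ∧ ‖e (n * x) - 1‖ ≤ 7 / N := by
  obtain ⟨n, hn, hnN, h⟩ := Real.exists_nat_abs_mul_sub_round_le x hN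
  refine ⟨n, hn, hnN, ?_⟩
  have hN' : (0 : ℝ) < N := by exact_mod_cast hN
  have h1 : e (n * x) = e (n * x - round (n * x)) := by
    conv_lhs => rw [← sub_add_cancel (n * x : ℝ) (round (n * x) : ℝ), e_add, e_int, mul_one]
  rw [h1]
  refine (norm_e_sub_one_le _).trans ?_
  calc 2 * Real.pi * |n * x - round (n * x)| ≤ 7 * (1 / N) := by
        gcongr
        · linarith [Real.pi_lt_d2]
        · exact h.trans (by gcongr; linarith)
    _ = 7 / N := by ring

/-! ### Good simultaneous return times -/

/-- The return time `n` is under control for the rotation by `γ`, at scale `X`: either the rotation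
by `n * γ` is extremely small, or it is at most comparable with all the small divisors of order
at most `X`. -/
def ReturnControl (γ : ℝ) (X n : ℕ) : Prop :=
  n * ‖e (n * γ) - 1‖ ≤ 1 ∨
    ∃ κ : ℝ, 0 < κ ∧ (∀ m : ℕ, 0 < m → m ≤ X → κ ≤ ‖e (m * γ) - 1‖) ∧ ‖e (n * γ) - 1‖ ≤ 7 * κ

/-- `γ` has a denominator at most `X` with error less than `X ^ (-a)`. -/
def WellApprox (γ : ℝ) (X a : ℕ) : Prop :=
  ∃ m : ℕ, 0 < m ∧ m ≤ X ∧ ‖e (m * γ) - 1‖ < 1 / (X : ℝ) ^ a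

lemma WellApprox.mono {γ : ℝ} {X a b : ℕ} (hX : 0 < X) (hab : a ≤ b) (h : WellApprox γ X b) :
    WellApprox γ X a := by
  obtain ⟨m, hm, hmX, h⟩ := h
  refine ⟨m, hm, hmX, h.trans_le ?_⟩
  have : (1 : ℝ) ≤ X := by exact_mod_cast hX
  gcongr

/-- There is a range of exponents in which neither frequency changes its behaviour. -/
lemma exists_stable_exponent (α β : ℝ) {X : ℕ} (hX : 0 < X) :
    ∃ b : ℕ, 0 < b ∧ b ≤ 78 ∧
      (WellApprox α X (6 * b + 6) ∨ ¬ WellApprox α X b) ∧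
      (WellApprox β X (6 * b + 6) ∨ ¬ WellApprox β X b) := by
  have mono : ∀ {γ a b}, a ≤ b → WellApprox γ X b → WellApprox γ X a :=
    fun h h' ↦ h'.mono hX h
  have hα := mono (γ := α) (show 12 ≤ 78 by norm_num)
  have hβ := mono (γ := β) (show 12 ≤ 78 by norm_num)
  have h1 : (WellApprox α X 12 ∨ ¬ WellApprox α X 1) ∧ (WellApprox β X 12 ∨ ¬ WellApprox β X 1) ∨
      (WellApprox α X 78 ∨ ¬ WellApprox α X 12) ∧ (WellApprox β X 78 ∨ ¬ WellApprox β X 12) ∨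
      (WellApprox α X 474 ∨ ¬ WellApprox α X 78) ∧
        (WellApprox β X 474 ∨ ¬ WellApprox β X 78) := by
    generalize WellApprox α X 1 = a₀, WellApprox α X 12 = a₁, WellApprox α X 78 = a₂,
      WellApprox α X 474 = a₃, WellApprox β X 1 = b₀, WellApprox β X 12 = b₁,
      WellApprox β X 78 = b₂, WellApprox β X 474 = b₃ at hα hβ ⊢
    tauto
  rcases h1 with h | h | h
  exacts [⟨1, by norm_num, by norm_num, h⟩, ⟨12, by norm_num, by norm_num, h⟩,
    ⟨78, by norm_num, by norm_num, h⟩]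

/-- A denominator to be used as a factor of the return time. -/
lemma exists_factor {γ : ℝ} {X b : ℕ} (hX : 0 < X)
    (h : WellApprox γ X (6 * b + 6) ∨ ¬ WellApprox γ X b) :
    ∃ m : ℕ, 0 < m ∧ m ≤ X ∧ ∀ k : ℕ, k * m ≤ X ^ (3 * b + 3) →
      ‖e ((k * m : ℕ) * γ) - 1‖ ≤ 7 / (X : ℝ) ^ b → ReturnControl γ X (k * m) := by
  have hX' : (1 : ℝ) ≤ X := by exact_mod_cast hX
  rcases h with ⟨m, hm, hmX, h⟩ | h
  · refine ⟨m, hm, hmX, fun k hk _ ↦ Or.inl ?_⟩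
    have hm' : (1 : ℝ) ≤ m := by exact_mod_cast hm
    have hk' : ((k * m : ℕ) : ℝ) ≤ (X : ℝ) ^ (3 * b + 3) := by exact_mod_cast hk
    have h2 : ‖e ((k * m : ℕ) * γ) - 1‖ ≤ (k * m : ℕ) * ‖e (m * γ) - 1‖ := by
      have := norm_e_nat_mul_sub_one_le k (m * γ)
      rw [← mul_assoc] at this
      push_cast
      refine this.trans ?_
      gcongr
      exact le_mul_of_one_le_right (by positivity) hm'
    calc ((k * m : ℕ) : ℝ) * ‖e ((k * m : ℕ) * γ) - 1‖
        ≤ (k * m : ℕ) * ((k * m : ℕ) * ‖e (m * γ) - 1‖) := by gcongr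
      _ ≤ (X : ℝ) ^ (3 * b + 3) * ((X : ℝ) ^ (3 * b + 3) * (1 / (X : ℝ) ^ (6 * b + 6))) := by
          gcongr
      _ = 1 := by
          have : (X : ℝ) ^ (6 * b + 6) = (X : ℝ) ^ (3 * b + 3) * (X : ℝ) ^ (3 * b + 3) := by
            rw [← pow_add]; congr 1; ring
          rw [this]
          field_simp
  · refine ⟨1, one_pos, hX, fun k _ hk ↦ Or.inr ⟨1 / (X : ℝ) ^ b, by positivity, ?_, ?_⟩⟩
    · intro m hm hmX
      by_contra! hlt
      exact h ⟨m, hm, hmX, hlt⟩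
    · rwa [mul_one_div]

/-- Two frequencies have a common controlled return time of polynomial size. -/
lemma exists_returnControl (α β : ℝ) {X : ℕ} (hX : 0 < X) :
    ∃ n : ℕ, X ≤ n ∧ n ≤ X ^ 237 ∧ ReturnControl α X n ∧ ReturnControl β X n := by
  obtain ⟨b, hb, hb', hα, hβ⟩ := exists_stable_exponent α β hX
  obtain ⟨m₁, hm₁, hm₁X, h₁⟩ := exists_factor hX hα
  obtain ⟨m₂, hm₂, hm₂X, h₂⟩ := exists_factor hX hβ
  set r := X * m₁ * m₂ with hr
  obtain ⟨k₁, hk₁, hk₁X, hk₁e⟩ :=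
    exists_norm_e_nat_mul_sub_one_le (r * α) (N := X ^ (2 * b)) (by positivity)
  obtain ⟨k₂, hk₂, hk₂X, hk₂e⟩ :=
    exists_norm_e_nat_mul_sub_one_le (k₁ * (r * β)) (N := X ^ b) (by positivity)
  have hle : k₂ * k₁ * X * m₁ * m₂ ≤ X ^ (3 * b + 3) :=
    calc k₂ * k₁ * X * m₁ * m₂ ≤ X ^ b * X ^ (2 * b) * X * X * X := by gcongr
      _ = X ^ (3 * b + 3) := by ring
  have hXR : (0 : ℝ) < X := by exact_mod_cast hX
  refine ⟨k₂ * k₁ * X * m₁ * m₂, ?_, hle.trans ?_, ?_, ?_⟩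
  · calc X = 1 * 1 * X * 1 * 1 := by ring
      _ ≤ k₂ * k₁ * X * m₁ * m₂ := by gcongr <;> assumption
  · exact Nat.pow_le_pow_right hX (by omega)
  · have hn : k₂ * k₁ * X * m₁ * m₂ = k₂ * k₁ * X * m₂ * m₁ := by ring
    rw [hn] at hle ⊢
    refine h₁ _ hle ?_
    have hg : ((k₂ * k₁ * X * m₂ * m₁ : ℕ) : ℝ) * α = k₂ * (k₁ * (r * α)) := by
      rw [hr]; push_cast; ring
    rw [hg]
    calc _ ≤ k₂ * ‖e (k₁ * (r * α)) - 1‖ := norm_e_nat_mul_sub_one_le _ _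
      _ ≤ (X : ℝ) ^ b * (7 / (X : ℝ) ^ (2 * b)) := by
          gcongr
          · exact_mod_cast hk₂X
          · exact_mod_cast hk₁e
      _ = 7 / (X : ℝ) ^ b := by
          rw [two_mul, pow_add]; field_simp
  · refine h₂ _ hle ?_
    have hg : ((k₂ * k₁ * X * m₁ * m₂ : ℕ) : ℝ) * β = k₂ * (k₁ * (r * β)) := by
      rw [hr]; push_cast; ring
    rw [hg]
    exact_mod_cast hk₂e

/-! ### Bounds for the symmetrized exponential sums -/

/-- The exponential sum over the forward orbit of length `n` minus that over the backward orbit. -/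
noncomputable def orbitSum (n : ℕ) (t : ℝ) : ℂ :=
  ∑ k ∈ Finset.range n, (e (k * t) - e ((k - n) * t))

lemma orbitSum_eq (n : ℕ) (t : ℝ) :
    orbitSum n t = (1 - e (-(n * t))) * ∑ k ∈ Finset.range n, e t ^ k := by
  rw [orbitSum, Finset.mul_sum]
  refine Finset.sum_congr rfl fun k _ ↦ ?_
  rw [sub_mul, sub_eq_add_neg (k * t), e_add, e_nat_mul]
  ring

lemma norm_orbitSum_le (n : ℕ) (t : ℝ) : ‖orbitSum n t‖ ≤ ‖e (n * t) - 1‖ * n := by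
  rw [orbitSum_eq, norm_mul, norm_one_sub_e_neg]
  gcongr
  refine (norm_sum_le _ _).trans ?_
  simp [norm_e]

lemma norm_orbitSum_le_two_mul (n : ℕ) (t : ℝ) : ‖orbitSum n t‖ ≤ 2 * n :=
  (norm_orbitSum_le n t).trans (by gcongr; exact norm_e_sub_one_le_two _)

lemma norm_orbitSum_mul_le (n : ℕ) (t : ℝ) :
    ‖orbitSum n t‖ * ‖e t - 1‖ ≤ 2 * ‖e (n * t) - 1‖ := by
  rw [orbitSum_eq, norm_mul, norm_one_sub_e_neg, mul_assoc, ← norm_mul, geom_sum_mul,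
    ← e_nat_mul, mul_comm]
  gcongr
  exact norm_e_sub_one_le_two _

/-- The terms of the Fourier expansion are uniformly summable along controlled return times. -/
lemma ReturnControl.norm_term_le {γ : ℝ} {X n : ℕ} (h : ReturnControl γ X n) (hn : n ≤ X ^ 237)
    {C : ℝ} {W : ℂ} {m : ℕ} (hW : (m : ℝ) ^ 239 * ‖W‖ ≤ C) {c : ℂ} (hc : ‖c‖ ≤ 1) :
    ‖c / m * (W * orbitSum n (m * γ))‖ ≤ 14 * C * (1 / (m : ℝ) ^ 2) := by
  rcases Nat.eq_zero_or_pos m with rfl | hm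
  · simp
  have hm1 : (1 : ℝ) ≤ m := by exact_mod_cast hm
  have hm0 : (0 : ℝ) < m := by linarith
  have hC : 0 ≤ C := le_trans (by positivity) hW
  set E := ‖orbitSum n (m * γ)‖ with hE
  have hE0 : 0 ≤ E := norm_nonneg _
  have hδ : ‖e (n * (m * γ)) - 1‖ ≤ m * ‖e (n * γ) - 1‖ := by
    rw [mul_left_comm]
    exact norm_e_nat_mul_sub_one_le _ _
  have key : E ≤ 14 * (m : ℝ) ^ 237 := by
    have hm2 : (m : ℝ) ≤ (m : ℝ) ^ 237 := le_self_pow₀ hm1 (by norm_num)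
    rcases h with h | ⟨κ, hκ, hbig, hsmall⟩
    · have : E ≤ m := by
        calc E ≤ ‖e (n * (m * γ)) - 1‖ * n := norm_orbitSum_le _ _
          _ ≤ m * ‖e (n * γ) - 1‖ * n := by gcongr
          _ = m * (n * ‖e (n * γ) - 1‖) := by ring
          _ ≤ m * 1 := by gcongr
          _ = m := mul_one _
      nlinarith
    · rcases le_or_gt m X with hmX | hmX
      · have h1 : E * κ ≤ 14 * m * κ :=
          calc E * κ ≤ E * ‖e (m * γ) - 1‖ := by gcongr; exact hbig m hm hmX
            _ ≤ 2 * ‖e (n * (m * γ)) - 1‖ := norm_orbitSum_mul_le _ _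
            _ ≤ 2 * (m * (7 * κ)) := by gcongr; exact hδ.trans (by gcongr)
            _ = 14 * m * κ := by ring
        have := le_of_mul_le_mul_right h1 hκ
        nlinarith
      · have h1 : (n : ℝ) ≤ (m : ℝ) ^ 237 := by
          exact_mod_cast hn.trans (Nat.pow_le_pow_left hmX.le _)
        have := norm_orbitSum_le_two_mul n (m * γ)
        linarith
  rw [norm_mul, norm_mul, norm_div, Complex.norm_natCast, ← hE]
  calc ‖c‖ / m * (‖W‖ * E) ≤ 1 / 1 * (‖W‖ * (14 * (m : ℝ) ^ 237)) := by gcongr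
    _ = 14 * ((m : ℝ) ^ 239 * ‖W‖) * (1 / (m : ℝ) ^ 2) := by
        rw [show (m : ℝ) ^ 239 = (m : ℝ) ^ 237 * (m : ℝ) ^ 2 from by rw [← pow_add]]
        field_simp
    _ ≤ 14 * C * (1 / (m : ℝ) ^ 2) := by gcongr

/-! ### Averages of logarithms along orbits -/

/-- The sum of `log ‖1 - a e(γ ·)‖` over the forward orbit of length `n` of `x`, minus the sum over
the backward orbit. -/
noncomputable def logDiff (a : ℂ) (γ : ℝ) (n : ℕ) (x : ℝ) : ℝ :=
  ∑ k ∈ Finset.range n,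
    (Real.log ‖1 - a * e (γ * (x + k))‖ - Real.log ‖1 - a * e (γ * (x + (k - n)))‖)

lemma hasSum_logDiff {a : ℂ} (ha : ‖a‖ < 1) (γ : ℝ) (n : ℕ) (x : ℝ) :
    ∃ z : ℂ, z.re = -logDiff a γ n x ∧
      HasSum (fun m : ℕ ↦ a ^ m / m * (e (m * γ * x) * orbitSum n (m * γ))) z := by
  have hs : ∀ y : ℝ, HasSum (fun m : ℕ ↦ a ^ m / m * e (m * (γ * y)))
      (-Complex.log (1 - a * e (γ * y))) := fun y ↦ by
    have : ‖a * e (γ * y)‖ < 1 := by rwa [norm_mul, norm_e, mul_one]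
    convert Complex.hasSum_taylorSeries_neg_log this using 2 with m
    rw [mul_pow, e_nat_mul]
    ring
  refine ⟨∑ k ∈ Finset.range n, (-Complex.log (1 - a * e (γ * (x + k))) -
    -Complex.log (1 - a * e (γ * (x + (k - n))))), ?_, ?_⟩
  · simp only [Complex.re_sum, Complex.sub_re, Complex.neg_re, Complex.log_re, logDiff,
      ← Finset.sum_neg_distrib]
    refine Finset.sum_congr rfl fun k _ ↦ by ring
  · convert hasSum_sum (s := Finset.range n) fun k _ ↦
      (hs (x + k)).sub (hs (x + (k - n))) using 2 with m
    · rfl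
    rw [orbitSum, Finset.mul_sum, Finset.mul_sum]
    refine Finset.sum_congr rfl fun k _ ↦ ?_
    rw [show (m : ℝ) * (γ * (x + k)) = m * γ * x + k * (m * γ) by ring,
      show (m : ℝ) * (γ * (x + (k - n))) = m * γ * x + (k - n) * (m * γ) by ring, e_add, e_add]
    ring

lemma exists_pow_mul_norm_integral_le {w : ℝ → ℝ} (hw : ContDiff ℝ ((⊤ : ℕ∞) : WithTop ℕ∞) w)
    (hw' : HasCompactSupport w) {γ : ℝ} (hγ : γ ≠ 0) (D : ℕ) :
    ∃ C : ℝ, ∀ m : ℕ, (m : ℝ) ^ D * ‖∫ x, (w x : ℂ) * e (m * γ * x)‖ ≤ C := by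
  have h1 : HasCompactSupport fun x ↦ (w x : ℂ) := hw'.comp_left (g := ((↑) : ℝ → ℂ)) (by simp)
  have h2 : ContDiff ℝ ((⊤ : ℕ∞) : WithTop ℕ∞) fun x ↦ (w x : ℂ) :=
    Complex.ofRealCLM.contDiff.comp hw
  obtain ⟨C, -, hC⟩ := (𝓕 (h1.toSchwartzMap h2)).decay D 0
  refine ⟨C / |γ| ^ D, fun m ↦ ?_⟩
  have h := hC (-(m * γ))
  rw [norm_iteratedFDeriv_zero, SchwartzMap.fourier_coe, Real.fourier_real_eq_integral_exp_smul,
    Real.norm_eq_abs, abs_neg, abs_mul, mul_pow, Nat.abs_cast] at h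
  rw [le_div_iff₀ (by positivity)]
  refine le_trans (le_of_eq ?_) h
  rw [mul_right_comm]
  congr 3
  ext x
  rw [h1.toSchwartzMap_toFun h2, smul_eq_mul, mul_comm, e_eq_exp_mul_I]
  congr 3
  push_cast
  ring

lemma norm_integral_mul_logDiff_le_of_lt {w : ℝ → ℝ} (hw : Continuous w)
    (hw' : HasCompactSupport w) {γ C : ℝ}
    (hC : ∀ m : ℕ, (m : ℝ) ^ 239 * ‖∫ x, (w x : ℂ) * e (m * γ * x)‖ ≤ C)
    {X n : ℕ} (h : ReturnControl γ X n) (hn : n ≤ X ^ 237) {a : ℂ} (ha : ‖a‖ < 1) :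
    |∫ x, w x * logDiff a γ n x| ≤ 14 * C * ∑' m : ℕ, 1 / (m : ℝ) ^ 2 := by
  have hce := continuous_e
  have hwi : Integrable w := hw.integrable_of_hasCompactSupport hw'
  choose L hL hLs using hasSum_logDiff ha γ n
  set F : ℕ → ℝ → ℂ := fun m x ↦
    (w x : ℂ) * (a ^ m / m * (e (m * γ * x) * orbitSum n (m * γ))) with hF
  have hFs : ∀ x, HasSum (fun m ↦ F m x) (w x * L x) := fun x ↦ (hLs x).mul_left _
  have hFi : ∀ m, Integrable (F m) := fun m ↦ by
    refine Continuous.integrable_of_hasCompactSupport (by fun_prop) ?_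
    exact (hw'.comp_left (g := ((↑) : ℝ → ℂ)) (by simp)).mul_right
  have hFn : ∀ m x, ‖F m x‖ ≤ ‖a‖ ^ m * (2 * n) * ‖w x‖ := fun m x ↦ by
    rw [hF]
    simp only [norm_mul, norm_e, norm_div, norm_pow, Complex.norm_natCast, Complex.norm_real]
    rw [mul_comm, one_mul]
    gcongr
    · rcases Nat.eq_zero_or_pos m with rfl | hm
      · simp
      · exact div_le_self (by positivity) (by exact_mod_cast hm)
    · exact norm_orbitSum_le_two_mul _ _
  have hsum : Summable fun m ↦ ∫ x, ‖F m x‖ := by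
    refine Summable.of_nonneg_of_le (fun m ↦ integral_nonneg fun x ↦ norm_nonneg _)
      (fun m ↦ integral_mono (hFi m).norm (hwi.norm.const_mul _) (hFn m)) ?_
    simp_rw [integral_const_mul, mul_assoc]
    exact (summable_geometric_of_lt_one (norm_nonneg _) ha).mul_right _
  have hasInt := hasSum_integral_of_summable_integral_norm (F := fun m x ↦ (F m x).re)
    (fun m ↦ (hFi m).re) (hsum.of_nonneg_of_le (fun m ↦ integral_nonneg fun x ↦ norm_nonneg _)
      fun m ↦ integral_mono (hFi m).re.norm (hFi m).norm fun x ↦ Complex.abs_re_le_norm _)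
  have hFint : ∀ m, ∫ x, F m x =
      a ^ m / m * ((∫ x, (w x : ℂ) * e (m * γ * x)) * orbitSum n (m * γ)) := fun m ↦ by
    rw [← integral_mul_const, ← integral_const_mul]
    congr 1
    ext x
    simp only [hF]
    ring
  have hFre : ∀ m, ∫ x, (F m x).re = (∫ x, F m x).re := fun m ↦
    Complex.reCLM.integral_comp_comm (hFi m)
  have hre : ∫ x, w x * logDiff a γ n x = -∫ x, ∑' m, (F m x).re := by
    rw [← integral_neg]
    congr 1
    ext x
    rw [(Complex.hasSum_re (hFs x)).tsum_eq, Complex.re_ofReal_mul, hL]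
    ring
  rw [hre, abs_neg, ← hasInt.tsum_eq, ← Real.norm_eq_abs]
  refine tsum_of_norm_bounded
    ((Real.summable_one_div_nat_pow.2 one_lt_two).hasSum.mul_left _) fun m ↦ ?_
  rw [hFre, Real.norm_eq_abs]
  refine (Complex.abs_re_le_norm _).trans ?_
  rw [hFint]
  exact h.norm_term_le hn (hC m) (by rw [norm_pow]; exact pow_le_one₀ (norm_nonneg _) ha.le)

lemma countable_setOf_e_mul_eq {γ : ℝ} (hγ : γ ≠ 0) (z : ℂ) :
    {x : ℝ | e (γ * x) = z}.Countable := by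
  rcases Set.eq_empty_or_nonempty {x : ℝ | e (γ * x) = z} with h | ⟨x₀, hx₀⟩
  · simp [h]
  refine (Set.countable_range fun k : ℤ ↦ x₀ + k / γ).mono fun x hx ↦ ?_
  rw [Set.mem_ofPred_eq] at hx hx₀
  have h1 : e (γ * (x - x₀)) = 1 := by
    rw [mul_sub, sub_eq_add_neg, e_add, e_neg, hx, hx₀, mul_inv_cancel₀]
    exact hx₀ ▸ e_ne_zero _
  obtain ⟨k, hk⟩ := e_eq_one_iff.1 h1
  refine ⟨k, ?_⟩
  simp only [← hk]
  field_simp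
  ring

lemma countable_setOf_one_sub_eq_zero (a : ℂ) {γ : ℝ} (hγ : γ ≠ 0) (c : ℝ) :
    {x : ℝ | 1 - a * e (γ * (x + c)) = 0}.Countable := by
  refine (countable_setOf_e_mul_eq hγ (a⁻¹ * e (-(γ * c)))).mono fun x hx ↦ ?_
  rw [Set.mem_ofPred_eq, sub_eq_zero] at hx
  rw [Set.mem_ofPred_eq]
  have ha : a ≠ 0 := by
    rintro rfl
    simp at hx
  rw [e_neg, ← mul_right_inj' ha, ← mul_assoc, mul_inv_cancel₀ ha, one_mul,
    ← mul_eq_one_iff_eq_inv₀ (e_ne_zero _), mul_assoc, ← e_add, ← mul_add, ← hx]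

lemma integrable_mul_log {w : ℝ → ℝ} (hw : Continuous w) (hw' : HasCompactSupport w) (a : ℂ)
    (γ c : ℝ) : Integrable fun x ↦ w x * Real.log ‖1 - a * e (γ * (x + c))‖ := by
  refine LocallyIntegrable.integrable_smul_left_of_hasCompactSupport ?_ hw hw'
  have hm : ∀ s : Set ℝ, MeromorphicOn (fun x : ℝ ↦ 1 - a * e (γ * (x + c))) s := fun s ↦ by
    refine AnalyticOnNhd.meromorphicOn fun x _ ↦ ?_
    have h1 : AnalyticAt ℝ (fun x : ℝ ↦ (x : ℂ)) x := Complex.ofRealCLM.analyticAt x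
    have h2 : AnalyticAt ℝ (fun x : ℝ ↦ 2 * Real.pi * Complex.I * (γ * ((x : ℂ) + c))) x :=
      analyticAt_const.mul (analyticAt_const.mul (h1.add analyticAt_const))
    have h3 : AnalyticAt ℝ Complex.exp (2 * Real.pi * Complex.I * (γ * ((x : ℂ) + c))) :=
      analyticAt_cexp.restrictScalars
    have h4 : AnalyticAt ℝ
        (fun x : ℝ ↦ Complex.exp (2 * Real.pi * Complex.I * (γ * ((x : ℂ) + c)))) x :=
      AnalyticAt.fun_comp (g := Complex.exp) h3 h2
    refine ((analyticAt_const (v := (1 : ℂ))).sub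
      ((analyticAt_const (v := a)).mul h4)).congr (.of_forall fun y ↦ ?_)
    simp [e]
  refine locallyIntegrable_iff.2 fun K hK ↦ ?_
  obtain ⟨R, hR⟩ := hK.isBounded.subset_closedBall 0
  rw [Real.closedBall_eq_Icc] at hR
  have hi := (MeromorphicOn.intervalIntegrable_log_norm (hm (Set.uIcc (0 - |R|) (0 + |R|))))
  rw [intervalIntegrable_iff_integrableOn_Icc_of_le (by linarith [abs_nonneg R])] at hi
  exact hi.mono_set (hR.trans (Set.Icc_subset_Icc (by linarith [le_abs_self R])
    (by linarith [le_abs_self R])))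

lemma abs_log_norm_one_sub_le {z : ℂ} (hz : ‖z‖ ≤ 1) (hz1 : 1 - z ≠ 0) {r : ℝ} (hr : 0 ≤ r)
    (hr1 : r ≤ 1) : |Real.log ‖1 - r * z‖| ≤ |Real.log ‖1 - z‖| + Real.log 2 := by
  have hpos : 0 < ‖1 - z‖ := norm_pos_iff.2 hz1
  have hrz : ‖(r : ℂ) * z‖ ≤ r := by
    rw [norm_mul, Complex.norm_real, Real.norm_of_nonneg hr]
    exact mul_le_of_le_one_right hr hz
  have h1 : 1 - r ≤ ‖1 - r * z‖ := by
    have := norm_sub_norm_le 1 (r * z)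
    rw [norm_one] at this
    linarith
  have h2 : ‖1 - z‖ ≤ 2 * ‖1 - r * z‖ := by
    have h3 : 1 - z = (1 - r * z) - (1 - r : ℝ) * z := by push_cast; ring
    have h4 : ‖((1 - r : ℝ) : ℂ) * z‖ ≤ 1 - r := by
      rw [norm_mul, Complex.norm_real, Real.norm_of_nonneg (by linarith)]
      exact mul_le_of_le_one_right (by linarith) hz
    rw [h3]
    exact (norm_sub_le _ _).trans (by linarith)
  have h5 : ‖1 - r * z‖ ≤ 2 := (norm_sub_le _ _).trans (by rw [norm_one]; linarith)
  have h6 : 0 < ‖1 - r * z‖ := by linarith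
  have h7 : Real.log ‖1 - z‖ ≤ Real.log 2 + Real.log ‖1 - r * z‖ := by
    rw [← Real.log_mul two_ne_zero h6.ne']
    exact Real.log_le_log hpos h2
  have h8 : Real.log ‖1 - r * z‖ ≤ Real.log 2 := Real.log_le_log h6 h5
  rw [abs_le]
  constructor
  · linarith [neg_abs_le (Real.log ‖1 - z‖)]
  · linarith [abs_nonneg (Real.log ‖1 - z‖)]

lemma integrable_mul_logDiff {w : ℝ → ℝ} (hw : Continuous w) (hw' : HasCompactSupport w) (a : ℂ)
    (γ : ℝ) (n : ℕ) : Integrable fun x ↦ w x * logDiff a γ n x := by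
  simp only [logDiff, Finset.mul_sum, mul_sub]
  exact integrable_finsetSum _ fun k _ ↦
    (integrable_mul_log hw hw' a γ k).sub (integrable_mul_log hw hw' a γ (k - n))

lemma tendsto_integral_mul_log {w : ℝ → ℝ} (hw : Continuous w) (hw' : HasCompactSupport w) {a : ℂ}
    (ha : ‖a‖ ≤ 1) {γ : ℝ} (hγ : γ ≠ 0) (c : ℝ) :
    Tendsto (fun r : ℝ ↦ ∫ x, w x * Real.log ‖1 - (r * a) * e (γ * (x + c))‖) (𝓝[<] 1)
      (𝓝 (∫ x, w x * Real.log ‖1 - a * e (γ * (x + c))‖)) := by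
  have hne := (countable_setOf_one_sub_eq_zero a hγ c).ae_notMem volume
  have hev : ∀ᶠ r : ℝ in 𝓝[<] 1, 0 ≤ r ∧ r ≤ 1 := by
    filter_upwards [Ioo_mem_nhdsLT zero_lt_one] with r hr using ⟨hr.1.le, hr.2.le⟩
  refine tendsto_integral_filter_of_dominated_convergence
    (fun x ↦ |w x * Real.log ‖1 - a * e (γ * (x + c))‖| + |w x| * Real.log 2)
    (.of_forall fun r ↦ (integrable_mul_log hw hw' _ γ c).aestronglyMeasurable) ?_
    ((integrable_mul_log hw hw' a γ c).abs.add
      ((hw.integrable_of_hasCompactSupport hw').abs.mul_const _)) ?_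
  · filter_upwards [hev] with r hr
    filter_upwards [hne] with x hx
    rw [Real.norm_eq_abs, abs_mul, abs_mul, ← mul_add, mul_assoc]
    gcongr
    exact abs_log_norm_one_sub_le (by rwa [norm_mul, norm_e, mul_one]) hx hr.1 hr.2
  · filter_upwards [hne] with x hx
    refine (Tendsto.log ?_ (norm_ne_zero_iff.2 hx)).const_mul _
    have : ContinuousAt (fun r : ℝ ↦ ‖1 - (r * a) * e (γ * (x + c))‖) 1 := by fun_prop
    have h := this.tendsto.mono_left (nhdsWithin_le_nhds (s := Set.Iio 1))
    simpa using h

/-- Smooth averages of `logDiff` are bounded along controlled return times. -/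
lemma exists_abs_integral_mul_logDiff_le {w : ℝ → ℝ}
    (hw : ContDiff ℝ ((⊤ : ℕ∞) : WithTop ℕ∞) w) (hw' : HasCompactSupport w) {γ : ℝ} (hγ : γ ≠ 0)
    {a : ℂ} (ha : ‖a‖ ≤ 1) :
    ∃ B : ℝ, ∀ X n : ℕ, ReturnControl γ X n → n ≤ X ^ 237 →
      |∫ x, w x * logDiff a γ n x| ≤ B := by
  obtain ⟨C, hC⟩ := exists_pow_mul_norm_integral_le hw hw' hγ 239
  refine ⟨14 * C * ∑' m : ℕ, 1 / (m : ℝ) ^ 2, fun X n h hn ↦ ?_⟩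
  have hwc := hw.continuous
  have hexp : ∀ b : ℂ, ∫ x, w x * logDiff b γ n x = ∑ k ∈ Finset.range n,
      ((∫ x, w x * Real.log ‖1 - b * e (γ * (x + k))‖) -
        ∫ x, w x * Real.log ‖1 - b * e (γ * (x + (k - n)))‖) := fun b ↦ by
    simp only [logDiff, Finset.mul_sum, mul_sub]
    rw [integral_finsetSum]
    · exact Finset.sum_congr rfl fun k _ ↦ integral_sub (integrable_mul_log hwc hw' b γ k)
        (integrable_mul_log hwc hw' b γ (k - n))
    · exact fun k _ ↦ (integrable_mul_log hwc hw' b γ k).sub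
        (integrable_mul_log hwc hw' b γ (k - n))
  have hlim : Tendsto (fun r : ℝ ↦ |∫ x, w x * logDiff (r * a) γ n x|) (𝓝[<] 1)
      (𝓝 |∫ x, w x * logDiff a γ n x|) := by
    refine Tendsto.abs ?_
    simp only [hexp]
    exact tendsto_finsetSum _ fun k _ ↦ (tendsto_integral_mul_log hwc hw' ha hγ k).sub
      (tendsto_integral_mul_log hwc hw' ha hγ (k - n))
  refine le_of_tendsto hlim ?_
  filter_upwards [Ioo_mem_nhdsLT zero_lt_one] with r hr
  refine norm_integral_mul_logDiff_le_of_lt hwc hw' hC h hn ?_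
  rw [norm_mul, Complex.norm_real, Real.norm_of_nonneg hr.1.le]
  nlinarith [hr.1, hr.2, norm_nonneg a]

/-! ### Functions vanishing at infinity with a two-term functional equation -/

section FunctionalEquation

variable {h : ℝ → ℂ} {a b : ℂ} {α β A B : ℝ}

lemma ne_zero_add_intCast (hA : 0 < A) (hB : 0 < B)
    (heq : ∀ x, A * ‖1 - a * e (α * x)‖ * ‖h x‖ = B * ‖1 - b * e (β * x)‖ * ‖h (x + 1)‖) {x : ℝ}
    (ha : ∀ k : ℤ, 1 - a * e (α * (x + k)) ≠ 0) (hb : ∀ k : ℤ, 1 - b * e (β * (x + k)) ≠ 0)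
    (hx : h x ≠ 0) (k : ℤ) : h (x + k) ≠ 0 := by
  have step : ∀ k : ℤ, h (x + k) ≠ 0 ↔ h (x + (k + 1 : ℤ)) ≠ 0 := fun k ↦ by
    have h1 := heq (x + k)
    have h2 := norm_ne_zero_iff.2 (ha k)
    have h3 := norm_ne_zero_iff.2 (hb k)
    rw [show x + ((k + 1 : ℤ) : ℝ) = x + k + 1 by push_cast; ring, ← norm_ne_zero_iff,
      ← norm_ne_zero_iff (a := h (x + k + 1))]
    constructor <;> intro h0 h0' <;> rw [h0', mul_zero] at h1
    · exact (mul_ne_zero (mul_ne_zero hA.ne' h2) h0) h1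
    · exact (mul_ne_zero (mul_ne_zero hB.ne' h3) h0) h1.symm
  induction k using Int.induction_on with
  | zero => simpa using hx
  | succ i ih => exact (step _).1 ih
  | pred i ih => exact (step _).2 (by simpa using ih)

lemma log_add_log_eq_logDiff_sub (hA : 0 < A) (hB : 0 < B)
    (heq : ∀ x, A * ‖1 - a * e (α * x)‖ * ‖h x‖ = B * ‖1 - b * e (β * x)‖ * ‖h (x + 1)‖) {x : ℝ}
    (ha : ∀ k : ℤ, 1 - a * e (α * (x + k)) ≠ 0) (hb : ∀ k : ℤ, 1 - b * e (β * (x + k)) ≠ 0)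
    (hx : h x ≠ 0) (n : ℕ) :
    Real.log ‖h (x + n)‖ + Real.log ‖h (x - n)‖ - 2 * Real.log ‖h x‖ =
      logDiff a α n x - logDiff b β n x := by
  have hne := ne_zero_add_intCast hA hB heq ha hb hx
  have step : ∀ k : ℤ, Real.log ‖h (x + k + 1)‖ - Real.log ‖h (x + k)‖ =
      Real.log A - Real.log B +
        (Real.log ‖1 - a * e (α * (x + k))‖ - Real.log ‖1 - b * e (β * (x + k))‖) := fun k ↦ by
    have h1 := congrArg Real.log (heq (x + k))
    have h2 := norm_ne_zero_iff.2 (ha k)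
    have h3 := norm_ne_zero_iff.2 (hb k)
    have h4 := norm_ne_zero_iff.2 (hne k)
    have h5 := norm_ne_zero_iff.2 (hne (k + 1))
    rw [Int.cast_add, Int.cast_one, ← add_assoc] at h5
    rw [Real.log_mul (mul_ne_zero hA.ne' h2) h4, Real.log_mul (mul_ne_zero hB.ne' h3) h5,
      Real.log_mul hA.ne' h2, Real.log_mul hB.ne' h3] at h1
    linarith
  have fwd := Finset.sum_range_sub (fun k : ℕ ↦ Real.log ‖h (x + k)‖) n
  have bwd := Finset.sum_range_sub (fun k : ℕ ↦ Real.log ‖h (x + (k - n))‖) n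
  simp only [Nat.cast_zero, add_zero, sub_self, zero_sub, ← sub_eq_add_neg] at fwd bwd
  have : Real.log ‖h (x + n)‖ + Real.log ‖h (x - n)‖ - 2 * Real.log ‖h x‖ =
      (Real.log ‖h (x + n)‖ - Real.log ‖h x‖) - (Real.log ‖h x‖ - Real.log ‖h (x - n)‖) := by ring
  rw [this, ← fwd, ← bwd, ← Finset.sum_sub_distrib, logDiff, logDiff, ← Finset.sum_sub_distrib]
  refine Finset.sum_congr rfl fun k _ ↦ ?_
  have s1 := step k
  have s2 := step (k - n)
  push_cast at s1 s2 ⊢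
  rw [show x + ((k : ℝ) + 1) = x + k + 1 by ring,
    show x + ((k : ℝ) + 1 - n) = x + (k - n) + 1 by ring, s1, s2]
  ring

/-- A continuous function vanishing at infinity whose translate by `1` is obtained by multiplication
with a quotient of two-term trigonometric polynomials is zero. -/
theorem eq_zero_of_norm_functional_equation (hc : Continuous h) (h0 : Tendsto h (cocompact ℝ) (𝓝 0))
    (hα : α ≠ 0) (hβ : β ≠ 0) (ha : ‖a‖ ≤ 1) (hb : ‖b‖ ≤ 1) (hA : 0 < A) (hB : 0 < B)
    (heq : ∀ x, A * ‖1 - a * e (α * x)‖ * ‖h x‖ = B * ‖1 - b * e (β * x)‖ * ‖h (x + 1)‖) (x₀ : ℝ) :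
    h x₀ = 0 := by
  by_contra hx₀
  set c := ‖h x₀‖ / 2 with hc_def
  have hc0 : 0 < c := by positivity
  obtain ⟨ρ, hρ, hball⟩ := Metric.eventually_nhds_iff_ball.1
    (hc.norm.continuousAt.eventually (lt_mem_nhds (show c < ‖h x₀‖ by
      have : 0 < ‖h x₀‖ := norm_pos_iff.2 hx₀
      rw [hc_def]; linarith)))
  let w : ContDiffBump x₀ := ⟨ρ / 2, ρ, by positivity, by linarith⟩
  have hws : ContDiff ℝ ((⊤ : ℕ∞) : WithTop ℕ∞) w := w.contDiff
  have hwc := w.hasCompactSupport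
  have hwsupp : ∀ x, w x ≠ 0 → x ∈ Metric.ball x₀ ρ := fun x hx ↦ by
    have : x ∈ Function.support w := hx
    rwa [w.support_eq] at this
  have hI : 0 < ∫ x, w x := w.integral_pos
  obtain ⟨B₁, hB₁⟩ := exists_abs_integral_mul_logDiff_le hws hwc hα ha
  obtain ⟨B₂, hB₂⟩ := exists_abs_integral_mul_logDiff_le hws hwc hβ hb
  set I := ∫ x, w x with hI_def
  set t := (B₁ + B₂ + 1) / (2 * I) with ht
  obtain ⟨R, hR⟩ : ∃ R : ℝ, ∀ y : ℝ, R ≤ |y| → ‖h y‖ ≤ c * Real.exp (-t) := by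
    have h1 := h0.norm
    rw [norm_zero] at h1
    have h2 := h1.eventually (ge_mem_nhds (show 0 < c * Real.exp (-t) by positivity))
    rw [← Metric.cobounded_eq_cocompact, ← comap_norm_atTop, eventually_comap] at h2
    obtain ⟨R, hR⟩ := eventually_atTop.1 h2
    exact ⟨R, fun y hy ↦ hR _ hy y rfl⟩
  obtain ⟨X, hX⟩ := exists_nat_ge (max 1 (R + |x₀| + ρ))
  have hX1 : 0 < X := by
    have : (1 : ℝ) ≤ X := (le_max_left _ _).trans hX
    exact_mod_cast this
  obtain ⟨n, hXn, hn, hnα, hnβ⟩ := exists_returnControl α β hX1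
  have hnR : R + |x₀| + ρ ≤ n := ((le_max_right _ _).trans hX).trans (by exact_mod_cast hXn)
  have hia := integrable_mul_logDiff hws.continuous hwc a α n
  have hib := integrable_mul_logDiff hws.continuous hwc b β n
  have haea : ∀ᵐ x : ℝ, ∀ k : ℤ, 1 - a * e (α * (x + k)) ≠ 0 :=
    ae_all_iff.2 fun k ↦ (countable_setOf_one_sub_eq_zero a hα k).ae_notMem volume
  have haeb : ∀ᵐ x : ℝ, ∀ k : ℤ, 1 - b * e (β * (x + k)) ≠ 0 :=
    ae_all_iff.2 fun k ↦ (countable_setOf_one_sub_eq_zero b hβ k).ae_notMem volume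
  have hle : ∫ x, (w x * logDiff a α n x - w x * logDiff b β n x) ≤ ∫ x, w x * (-(2 * t)) := by
    refine integral_mono_ae (hia.sub hib)
      ((hws.continuous.integrable_of_hasCompactSupport hwc).mul_const _) ?_
    filter_upwards [haea, haeb] with x hxa hxb
    rcases eq_or_ne (w x) 0 with hw0 | hw0
    · simp [hw0]
    have hxball := hwsupp x hw0
    have hcx := hball x hxball
    have hx0 : h x ≠ 0 := norm_pos_iff.1 (hc0.trans hcx)
    rw [← mul_sub, ← log_add_log_eq_logDiff_sub hA hB heq hxa hxb hx0]
    refine mul_le_mul_of_nonneg_left ?_ w.nonneg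
    have hne := ne_zero_add_intCast hA hB heq hxa hxb hx0
    have hsmall : ∀ y : ℝ, h y ≠ 0 → R ≤ |y| → Real.log ‖h y‖ ≤ Real.log c - t := fun y hy hyR ↦ by
      have := Real.log_le_log (norm_pos_iff.2 hy) (hR y hyR)
      rwa [Real.log_mul hc0.ne' (Real.exp_ne_zero _), Real.log_exp, ← sub_eq_add_neg] at this
    have hxabs : |x| ≤ |x₀| + ρ := by
      have h1 : |x - x₀| < ρ := by rwa [Metric.mem_ball, Real.dist_eq] at hxball
      have h2 := abs_sub_abs_le_abs_sub x x₀
      linarith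
    have h1 := hsmall (x + n) (by simpa using hne n) (by
      have := abs_sub_abs_le_abs_sub (n : ℝ) (-x)
      rw [Nat.abs_cast, abs_neg, sub_neg_eq_add, add_comm (n : ℝ)] at this
      linarith)
    have h2 := hsmall (x - n) (by simpa [sub_eq_add_neg] using hne (-n)) (by
      have := abs_sub_abs_le_abs_sub (n : ℝ) x
      rw [Nat.abs_cast, abs_sub_comm] at this
      linarith)
    have h3 := Real.log_le_log hc0 hcx.le
    linarith
  rw [integral_sub hia hib, integral_mul_const, ← hI_def,
    show I * (-(2 * t)) = -(B₁ + B₂ + 1) by rw [ht]; field_simp] at hle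
  have h1 := (abs_le.1 (hB₁ X n hnα hn)).1
  have h2 := (abs_le.1 (hB₂ X n hnβ hn)).2
  linarith

end FunctionalEquation

lemma exists_norm_two_term_eq {A₁ A₂ : ℂ} {u₁ u₂ : ℝ} (hu : u₁ ≠ u₂) (hA : A₁ ≠ 0 ∨ A₂ ≠ 0) :
    ∃ (A : ℝ) (a : ℂ) (γ : ℝ), 0 < A ∧ ‖a‖ ≤ 1 ∧ γ ≠ 0 ∧
      ∀ x, ‖A₁ * e (u₁ * x) + A₂ * e (u₂ * x)‖ = A * ‖1 - a * e (γ * x)‖ := by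
  wlog hle : ‖A₂‖ ≤ ‖A₁‖ generalizing A₁ A₂ u₁ u₂
  · obtain ⟨A, a, γ, h1, h2, h3, h⟩ := this hu.symm hA.symm (not_le.1 hle).le
    exact ⟨A, a, γ, h1, h2, h3, fun x ↦ by rw [add_comm, h]⟩
  have hA₁ : A₁ ≠ 0 := by
    rintro rfl
    rw [norm_zero, norm_le_zero_iff] at hle
    simp [hle] at hA
  refine ⟨‖A₁‖, -A₂ / A₁, u₂ - u₁, norm_pos_iff.2 hA₁, ?_, sub_ne_zero.2 hu.symm, fun x ↦ ?_⟩
  · rw [norm_div, norm_neg]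
    exact div_le_one_of_le₀ hle (norm_nonneg _)
  · have : A₁ * e (u₁ * x) + A₂ * e (u₂ * x) =
        e (u₁ * x) * (A₁ * (1 - -A₂ / A₁ * e ((u₂ - u₁) * x))) := by
      rw [show u₂ * x = u₁ * x + (u₂ - u₁) * x by ring, e_add]
      field_simp
      ring
    rw [this, norm_mul, norm_e, one_mul, norm_mul]

lemma eq_zero_of_two_term_mul_eq_zero {h : ℝ → ℂ} (hc : Continuous h) {A₁ A₂ : ℂ} {u₁ u₂ : ℝ}
    (hu : u₁ ≠ u₂) (hA : A₁ ≠ 0 ∨ A₂ ≠ 0)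
    (heq : ∀ x, (A₁ * e (u₁ * x) + A₂ * e (u₂ * x)) * h x = 0) (x : ℝ) : h x = 0 := by
  obtain ⟨A, a, γ, hA0, -, hγ, hnorm⟩ := exists_norm_two_term_eq hu hA
  have hd := (countable_setOf_one_sub_eq_zero a hγ 0).dense_compl ℝ
  refine congrFun (hc.ext_on hd continuous_const fun y hy ↦ ?_) x
  refine (mul_eq_zero.1 (heq y)).resolve_left fun h0 ↦ hy ?_
  have := hnorm y
  rw [h0, norm_zero, zero_eq_mul, norm_eq_zero] at this
  simpa using this.resolve_left hA0.ne'

/-- Independence for a configuration on two vertical lines, for continuous functions vanishing at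
infinity. -/
theorem eq_zero_of_vertical_configuration {h : ℝ → ℂ} (hc : Continuous h)
    (h0 : Tendsto h (cocompact ℝ) (𝓝 0)) {s₁ s₂ u₁ u₂ v₁ v₂ : ℝ} {A₁ A₂ B₁ B₂ : ℂ}
    (hs : s₁ ≠ s₂) (hu : u₁ ≠ u₂) (hv : v₁ ≠ v₂)
    (hAB : A₁ ≠ 0 ∨ A₂ ≠ 0 ∨ B₁ ≠ 0 ∨ B₂ ≠ 0)
    (heq : ∀ x, (A₁ * e (u₁ * x) + A₂ * e (u₂ * x)) * h (x + s₁) +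
      (B₁ * e (v₁ * x) + B₂ * e (v₂ * x)) * h (x + s₂) = 0) (x : ℝ) : h x = 0 := by
  by_cases hA : A₁ ≠ 0 ∨ A₂ ≠ 0
  swap
  · have hB : B₁ ≠ 0 ∨ B₂ ≠ 0 := by tauto
    obtain ⟨rfl, rfl⟩ : A₁ = 0 ∧ A₂ = 0 := by tauto
    have := eq_zero_of_two_term_mul_eq_zero (h := fun x ↦ h (x + s₂)) (by fun_prop) hv hB
      (fun x ↦ by simpa using heq x) (x - s₂)
    simpa using this
  by_cases hB : B₁ ≠ 0 ∨ B₂ ≠ 0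
  swap
  · obtain ⟨rfl, rfl⟩ : B₁ = 0 ∧ B₂ = 0 := by tauto
    have := eq_zero_of_two_term_mul_eq_zero (h := fun x ↦ h (x + s₁)) (by fun_prop) hu hA
      (fun x ↦ by simpa using heq x) (x - s₁)
    simpa using this
  have hs' : s₂ - s₁ ≠ 0 := sub_ne_zero.2 hs.symm
  obtain ⟨A, a, α, hA0, ha, hα, hP⟩ := exists_norm_two_term_eq hu hA
  obtain ⟨B, b, β, hB0, hb, hβ, hQ⟩ := exists_norm_two_term_eq hv hB
  have hemb : Topology.IsClosedEmbedding fun y : ℝ ↦ (s₂ - s₁) * y + s₁ :=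
    ((Homeomorph.mulLeft₀ _ hs').trans (Homeomorph.addRight s₁)).isClosedEmbedding
  have := eq_zero_of_norm_functional_equation (h := fun y ↦ h ((s₂ - s₁) * y + s₁)) (by fun_prop)
    (h0.comp hemb.tendsto_cocompact) (mul_ne_zero hα hs') (mul_ne_zero hβ hs') ha hb hA0 hB0
    (fun y ↦ by
      have h1 := congrArg norm (eq_neg_of_add_eq_zero_left (heq ((s₂ - s₁) * y)))
      rw [norm_neg, norm_mul, norm_mul, hP, hQ] at h1
      rw [mul_assoc α, mul_assoc β, h1]
      congr 3
      ring) ((x - s₁) / (s₂ - s₁))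
  rwa [mul_div_cancel₀ _ hs', sub_add_cancel] at this

/-! ### Reduction to vertical lines -/

lemma fourier_eq_integral_e (g : ℝ → ℂ) (y : ℝ) : 𝓕 g y = ∫ x, e (-(x * y)) * g x := by
  rw [Real.fourier_real_eq_integral_exp_smul]
  congr 1
  ext x
  rw [e_eq_exp_mul_I, smul_eq_mul]
  congr 4
  ring

lemma integral_e_mul_modulated_translate (g : ℝ → ℂ) (t ν y : ℝ) :
    ∫ x, e (-(x * y)) * (e (ν * x) * g (x + t)) = e (-(ν * t)) * e (t * y) * 𝓕 g (y + -ν) := by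
  rw [fourier_eq_integral_e, ← integral_const_mul, ← integral_add_right_eq_self
    (fun x ↦ e (-(ν * t)) * e (t * y) * (e (-(x * (y + -ν))) * g x)) t]
  congr 1
  ext x
  rw [← mul_assoc, ← mul_assoc, ← e_add, ← e_add, ← e_add]
  congr 2
  ring

/-- Independence for a configuration on two horizontal lines, for continuous integrable
functions. -/
theorem eq_zero_of_horizontal_configuration {g : ℝ → ℂ} (hc : Continuous g) (hg : Integrable g)
    {ν₁ ν₂ t₁ t₂ r₁ r₂ : ℝ} {A₁ A₂ B₁ B₂ : ℂ} (hν : ν₁ ≠ ν₂) (ht : t₁ ≠ t₂) (hr : r₁ ≠ r₂)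
    (hAB : A₁ ≠ 0 ∨ A₂ ≠ 0 ∨ B₁ ≠ 0 ∨ B₂ ≠ 0)
    (heq : ∀ x, A₁ * (e (ν₁ * x) * g (x + t₁)) + A₂ * (e (ν₁ * x) * g (x + t₂)) +
      (B₁ * (e (ν₂ * x) * g (x + r₁)) + B₂ * (e (ν₂ * x) * g (x + r₂))) = 0) (x : ℝ) :
    g x = 0 := by
  have hce := continuous_e
  have hi : ∀ y t ν (D : ℂ), Integrable fun x ↦ D * (e (-(x * y)) * (e (ν * x) * g (x + t))) :=
    fun y t ν D ↦ by
      refine Integrable.const_mul ?_ D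
      refine ((hg.comp_add_right t).norm).mono' (Continuous.aestronglyMeasurable (by fun_prop)) ?_
      refine ae_of_all _ fun x ↦ ?_
      simp only [norm_mul, norm_e, one_mul, le_refl]
  have hi₂ : ∀ y t t' ν (D D' : ℂ), Integrable fun x ↦
      D * (e (-(x * y)) * (e (ν * x) * g (x + t))) +
      D' * (e (-(x * y)) * (e (ν * x) * g (x + t'))) :=
    fun y t t' ν D D' ↦ (hi y t ν D).add (hi y t' ν D')
  have hF : ∀ y, 𝓕 g y = 0 := by
    refine eq_zero_of_vertical_configuration (s₁ := -ν₁) (s₂ := -ν₂) (u₁ := t₁) (u₂ := t₂)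
      (v₁ := r₁) (v₂ := r₂) (A₁ := A₁ * e (-(ν₁ * t₁))) (A₂ := A₂ * e (-(ν₁ * t₂)))
      (B₁ := B₁ * e (-(ν₂ * r₁))) (B₂ := B₂ * e (-(ν₂ * r₂)))
      (VectorFourier.fourierIntegral_continuous Real.continuous_fourierChar
        (L := innerₗ ℝ) continuous_inner hg)
      (Real.zero_at_infty_fourier g) (by simpa using hν) ht hr (by simpa [e_ne_zero] using hAB)
      fun y ↦ ?_
    have h1 : ∫ x, ((A₁ * (e (-(x * y)) * (e (ν₁ * x) * g (x + t₁))) +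
        A₂ * (e (-(x * y)) * (e (ν₁ * x) * g (x + t₂)))) +
        (B₁ * (e (-(x * y)) * (e (ν₂ * x) * g (x + r₁))) +
        B₂ * (e (-(x * y)) * (e (ν₂ * x) * g (x + r₂))))) = 0 := by
      rw [← integral_zero ℝ ℂ]
      congr 1
      ext x
      have := congrArg (e (-(x * y)) * ·) (heq x)
      simp only [mul_zero] at this
      rw [← this]
      ring
    rw [integral_add (hi₂ _ _ _ _ _ _) (hi₂ _ _ _ _ _ _),
      integral_add (hi _ _ _ _) (hi _ _ _ _), integral_add (hi _ _ _ _) (hi _ _ _ _)] at h1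
    simp only [integral_const_mul, integral_e_mul_modulated_translate] at h1
    rw [← h1]
    ring
  have hF' : 𝓕 g = 0 := funext hF
  rw [← hc.fourierInv_fourier_eq hg (by rw [hF']; exact integrable_zero _ _ _), hF',
    Real.fourierInv_eq]
  simp

/-- Multiplication with a chirp shears the time-frequency plane. -/
lemma mul_e_eq_chirp (f : ℝ → ℂ) (μ t ξ x : ℝ) :
    f (x + t) * e (ξ * x) = e (-(μ * x ^ 2)) * (e (-(μ * t ^ 2)) *
      (e ((ξ - 2 * μ * t) * x) * (f (x + t) * e (μ * (x + t) ^ 2)))) := by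
  rw [show f (x + t) * e (ξ * x) = f (x + t) * e (-(μ * x ^ 2) + (-(μ * t ^ 2) +
    ((ξ - 2 * μ * t) * x + μ * (x + t) ^ 2))) by ring_nf, e_add, e_add, e_add]
  ring

/-- Conjecture 1.2 (HRT for Schwartz functions) holds for (2,2) configurations:
four distinct points such that two distinct parallel lines each contain exactly two of them. -/
theorem hrt_schwartz_two_two_configurations
    (p : Fin 4 → ℝ × ℝ) (hp : Function.Injective p)
    (hconf : ∃ a b c₁ c₂ : ℝ, (a, b) ≠ ((0 : ℝ), (0 : ℝ)) ∧ c₁ ≠ c₂ ∧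
      {i : Fin 4 | a * (p i).1 + b * (p i).2 = c₁}.ncard = 2 ∧
      {i : Fin 4 | a * (p i).1 + b * (p i).2 = c₂}.ncard = 2)
    (f : SchwartzMap ℝ ℂ) (d : Fin 4 → ℂ) (hd : ∃ i, d i ≠ 0)
    (heq : ∀ᵐ x : ℝ, ∑ i, d i * f (x + (p i).1) * e ((p i).2 * x) = 0) :
    ∀ x : ℝ, f x = 0 := by
  obtain ⟨a, b, c₁, c₂, hab, hc, h₁, h₂⟩ := hconf
  obtain ⟨i, j, hij, hS⟩ := Set.ncard_eq_two.1 h₁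
  obtain ⟨k, l, hkl, hT⟩ := Set.ncard_eq_two.1 h₂
  have hS' : ∀ m, a * (p m).1 + b * (p m).2 = c₁ ↔ m = i ∨ m = j := fun m ↦ by
    simpa using Set.ext_iff.1 hS m
  have hT' : ∀ m, a * (p m).1 + b * (p m).2 = c₂ ↔ m = k ∨ m = l := fun m ↦ by
    simpa using Set.ext_iff.1 hT m
  have hi := (hS' i).2 (.inl rfl)
  have hj := (hS' j).2 (.inr rfl)
  have hk := (hT' k).2 (.inl rfl)
  have hl := (hT' l).2 (.inr rfl)
  have hdisj : Disjoint ({i, j} : Finset (Fin 4)) {k, l} := by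
    refine Finset.disjoint_left.2 fun m hm hm' ↦ hc ?_
    rw [← (hS' m).2 (by simpa using hm), ← (hT' m).2 (by simpa using hm')]
  have huniv : ({i, j} : Finset (Fin 4)) ∪ {k, l} = Finset.univ := by
    rw [← Finset.card_eq_iff_eq_univ, Finset.card_union_of_disjoint hdisj, Finset.card_pair hij,
      Finset.card_pair hkl]
    rfl
  have hd' : d i ≠ 0 ∨ d j ≠ 0 ∨ d k ≠ 0 ∨ d l ≠ 0 := by
    obtain ⟨m, hm⟩ := hd
    have : m ∈ ({i, j} : Finset (Fin 4)) ∪ {k, l} := huniv ▸ Finset.mem_univ m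
    simp only [Finset.mem_union, Finset.mem_insert, Finset.mem_singleton] at this
    rcases this with (rfl | rfl) | rfl | rfl <;> tauto
  have hfc := f.continuous
  have hce := continuous_e
  have heq' : ∀ x : ℝ, d i * (f (x + (p i).1) * e ((p i).2 * x)) +
      d j * (f (x + (p j).1) * e ((p j).2 * x)) +
      (d k * (f (x + (p k).1) * e ((p k).2 * x)) +
        d l * (f (x + (p l).1) * e ((p l).2 * x))) = 0 := by
    have h := (Continuous.ae_eq_iff_eq volume
      (f := fun x : ℝ ↦ ∑ i, d i * f (x + (p i).1) * e ((p i).2 * x)) (g := fun _ ↦ 0)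
      (by fun_prop) continuous_const).1 heq
    intro x
    have hx := congrFun h x
    rw [← huniv, Finset.sum_union hdisj, Finset.sum_pair hij, Finset.sum_pair hkl] at hx
    simpa only [mul_assoc] using hx
  rcases eq_or_ne b 0 with rfl | hb
  · have ha : a ≠ 0 := by
      rintro rfl
      exact hab rfl
    simp only [zero_mul, add_zero] at hi hj hk hl
    have hst : ∀ {m m'}, a * (p m).1 = a * (p m').1 → m ≠ m' → (p m).2 ≠ (p m').2 :=
      fun h hne h2 ↦ hne (hp (Prod.ext (mul_left_cancel₀ ha h) h2))
    have hji : (p j).1 = (p i).1 := mul_left_cancel₀ ha (hj.trans hi.symm)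
    have hlk : (p l).1 = (p k).1 := mul_left_cancel₀ ha (hl.trans hk.symm)
    refine eq_zero_of_vertical_configuration hfc (zero_at_infty f)
      (s₁ := (p i).1) (s₂ := (p k).1) (fun h ↦ hc (by rw [← hi, ← hk, h]))
      (hst (hi.trans hj.symm) hij) (hst (hk.trans hl.symm) hkl) hd' fun x ↦ ?_
    have := heq' x
    rw [hji, hlk] at this
    rw [← this]
    ring
  · have hst : ∀ {m m'}, a * (p m).1 + b * (p m).2 = a * (p m').1 + b * (p m').2 → m ≠ m' →
        (p m).1 ≠ (p m').1 := fun h hne h2 ↦ hne (hp (Prod.ext h2 (mul_left_cancel₀ hb (by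
      rw [h2] at h
      linarith))))
    set μ := -(a / b) / 2 with hμ
    have hν : ∀ {m c}, a * (p m).1 + b * (p m).2 = c → (p m).2 - 2 * μ * (p m).1 = c / b :=
      fun h ↦ by
        rw [hμ, ← h]
        field_simp
        ring
    have hg := eq_zero_of_horizontal_configuration (g := fun x ↦ f x * e (μ * x ^ 2))
      (by fun_prop) ((f.integrable (μ := volume)).norm.mono'
        (Continuous.aestronglyMeasurable (by fun_prop)) (ae_of_all _ fun x ↦ by simp [norm_e]))
      (A₁ := d i * e (-(μ * (p i).1 ^ 2))) (A₂ := d j * e (-(μ * (p j).1 ^ 2)))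
      (B₁ := d k * e (-(μ * (p k).1 ^ 2))) (B₂ := d l * e (-(μ * (p l).1 ^ 2)))
      (ν₁ := c₁ / b) (ν₂ := c₂ / b)
      (fun h ↦ hc ((div_left_inj' hb).1 h)) (hst (hi.trans hj.symm) hij)
      (hst (hk.trans hl.symm) hkl) (by simpa [e_ne_zero] using hd') fun x ↦ by
        have h := heq' x
        rw [mul_e_eq_chirp f μ (p i).1, mul_e_eq_chirp f μ (p j).1, mul_e_eq_chirp f μ (p k).1,
          mul_e_eq_chirp f μ (p l).1, hν hi, hν hj, hν hk, hν hl] at h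
        refine mul_left_cancel₀ (e_ne_zero (-(μ * x ^ 2))) ?_
        rw [mul_zero, ← h]
        ring
    exact fun x ↦ (mul_eq_zero.1 (hg x)).resolve_right (e_ne_zero _)
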